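/- Max-support policy: in the recommendation game with signal S (support X), assume some BIC recommendation policy for S exists. Then there exists a BIC recommendation policy π^max such that support(π^max(s)) = EX_s[S] for every s ∈ X, and p_min(π^max) ≥ p_min[S] / (|A|·|X|), where p_min[S] = min_{s∈X, a∈EX_s[S]} max_{x∈BIC[S]} x_{a,s}. -/

import Mathlib

open scoped BigOperators

attribute [local instance] Classical.propDecidable

noncomputable section

namespace BE

variable {n : ℕ} {Θ : Type} {A : Fin n → Type} {X : Type} {X' : Type}

/-- Joint actions: one action per agent. -/
abbrev JA (A : Fin n → Type) : Type := (i : Fin n) → A i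

/-- A realized utility vector: the principal's reward together with each agent's utility. -/
abbrev UVec (n : ℕ) : Type := ℝ × (Fin n → ℝ)

/-- A history: the joint actions chosen and the utility vectors realized so far,
most recent round first. -/
abbrev Hist (A : Fin n → Type) : Type := List (JA A × UVec n)

/-- A (discrete) probability mass function. -/
def IsDPMF {V : Type*} (m : V → ℝ) : Prop :=
  (∀ v, 0 ≤ m v) ∧ HasSum m 1

/-- A prior over the finite state space. -/
def IsPrior [Fintype Θ] (ψ : Θ → ℝ) : Prop :=
  (∀ θ, 0 ≤ ψ θ) ∧ ∑ θ, ψ θ = 1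

/-- Rewards and utilities take values in `[0,1]`. -/
def IsUtil (f : JA A → Θ → ℝ) (u : (i : Fin n) → JA A → Θ → ℝ) : Prop :=
  (∀ a θ, f a θ ∈ Set.Icc (0:ℝ) 1) ∧ ∀ i a θ, u i a θ ∈ Set.Icc (0:ℝ) 1

/-- A stochastic-utility environment `D`: for every joint action `a` and state `θ`,
`D a θ` is a distribution over realized utility vectors supported in `[0,1]^{n+1}`
whose coordinate means are `f a θ` and `u i a θ`. -/
def IsEnv (D : JA A → Θ → UVec n → ℝ) (f : JA A → Θ → ℝ)
    (u : (i : Fin n) → JA A → Θ → ℝ) : Prop :=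
  ∀ a θ, IsDPMF (D a θ) ∧
    (∀ v, D a θ v ≠ 0 → v.1 ∈ Set.Icc (0:ℝ) 1 ∧ ∀ i, v.2 i ∈ Set.Icc (0:ℝ) 1) ∧
    (∑' v : UVec n, D a θ v * v.1) = f a θ ∧
    (∀ i, (∑' v : UVec n, D a θ v * v.2 i) = u i a θ)

/-- The deterministic instance: realized utilities deterministically equal expectations. -/
def detD (f : JA A → Θ → ℝ) (u : (i : Fin n) → JA A → Θ → ℝ) :
    JA A → Θ → UVec n → ℝ :=
  fun a θ v => if v = ((f a θ, fun i => u i a θ) : UVec n) then (1:ℝ) else 0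

/-- An iterative recommendation policy, represented by its per-round conditional
action distributions given the history observed so far. -/
def IsPolicy [∀ i, Fintype (A i)] (P : ℕ → Hist A → JA A → ℝ) : Prop :=
  ∀ t h, (∀ a, 0 ≤ P t h a) ∧ ∑ a : JA A, P t h a = 1

/-- Probability, conditional on the realized state `θ`, of observing history `h`
when all agents follow the recommendations of policy `P` in environment `D`. -/
def histProb (P : ℕ → Hist A → JA A → ℝ) (D : JA A → Θ → UVec n → ℝ) (θ : Θ) :
    Hist A → ℝ
  | [] => 1
  | av :: h => histProb P D θ h * P h.length h av.1 * D av.1 θ av.2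

/-- Conditional (on `θ* = θ`) expectation of `g (aₜ, θ)` in round `t` (0-indexed). -/
def roundCond [∀ i, Fintype (A i)] (P : ℕ → Hist A → JA A → ℝ)
    (D : JA A → Θ → UVec n → ℝ) (θ : Θ) (t : ℕ) (g : JA A → Θ → ℝ) : ℝ :=
  ∑' h : Hist A,
    if h.length = t then histProb P D θ h * ∑ a : JA A, P t h a * g a θ else 0

/-- Expectation of `g (aₜ, θ*)` in round `t` (0-indexed). -/
def roundExp [Fintype Θ] [∀ i, Fintype (A i)] (ψ : Θ → ℝ)
    (P : ℕ → Hist A → JA A → ℝ) (D : JA A → Θ → UVec n → ℝ) (t : ℕ)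
    (g : JA A → Θ → ℝ) : ℝ :=
  ∑ θ, ψ θ * roundCond P D θ t g

/-- Conditional (on `θ* = θ`) probability that policy `P` plays the joint action `a`
in round `t` (0-indexed). -/
def probAt [∀ i, Fintype (A i)] (P : ℕ → Hist A → JA A → ℝ)
    (D : JA A → Θ → UVec n → ℝ) (θ : Θ) (t : ℕ) (a : JA A) : ℝ :=
  ∑' h : Hist A, if h.length = t then histProb P D θ h * P t h a else 0

/-- δ-Bayesian incentive-compatibility at round `t` (0-indexed), stated in the
equivalent indicator-weighted (unconditional) form: for every agent `i` and actions
`ai, ai'`, the expected gain of following the recommendation `ai` over deviating to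
`ai'` (weighted by the event of being recommended `ai`) is at least `δ` times the
probability of being recommended `ai`. -/
def BICAt [Fintype Θ] [∀ i, Fintype (A i)] (ψ : Θ → ℝ)
    (P : ℕ → Hist A → JA A → ℝ) (D : JA A → Θ → UVec n → ℝ)
    (u : (i : Fin n) → JA A → Θ → ℝ) (δ : ℝ) (t : ℕ) : Prop :=
  ∀ (i : Fin n) (ai ai' : A i),
    δ * roundExp ψ P D t (fun a _ => if a i = ai then 1 else 0) ≤
      roundExp ψ P D t
        (fun a θ => if a i = ai then u i a θ - u i (Function.update a i ai') θ else 0)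

/-- δ-BIC iterative recommendation policy (`δ = 0` is plain BIC). -/
def IsBIC [Fintype Θ] [∀ i, Fintype (A i)] (ψ : Θ → ℝ)
    (P : ℕ → Hist A → JA A → ℝ) (D : JA A → Θ → UVec n → ℝ)
    (u : (i : Fin n) → JA A → Θ → ℝ) (δ : ℝ) : Prop :=
  IsPolicy P ∧ ∀ t, BICAt ψ P D u δ t

/-- Cumulative expected reward over the first `T` rounds. -/
def REW [Fintype Θ] [∀ i, Fintype (A i)] (ψ : Θ → ℝ)
    (P : ℕ → Hist A → JA A → ℝ) (D : JA A → Θ → UVec n → ℝ)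
    (f : JA A → Θ → ℝ) (T : ℕ) : ℝ :=
  ∑ t ∈ Finset.range T, roundExp ψ P D t f

/-- The one-round benchmark `OPT` over a class `C` of policies. -/
def OPT [Fintype Θ] [∀ i, Fintype (A i)] (ψ : Θ → ℝ)
    (D : JA A → Θ → UVec n → ℝ) (f : JA A → Θ → ℝ)
    (C : (ℕ → Hist A → JA A → ℝ) → Prop) : ℝ :=
  sSup {r : ℝ | ∃ P, C P ∧ ∃ t : ℕ, r = roundExp ψ P D t f}

/-- A signal structure: the conditional distribution of the signal given the state. -/
def IsSigKernel (q : Θ → X → ℝ) : Prop :=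
  ∀ θ, (∀ s, 0 ≤ q θ s) ∧ HasSum (q θ) 1

/-- LP-representation of a recommendation policy in the recommendation game. -/
def IsRecPolicy [∀ i, Fintype (A i)] (x : JA A → X → ℝ) : Prop :=
  (∀ a s, 0 ≤ x a s) ∧ ∀ s, ∑ a : JA A, x a s = 1

/-- Membership in the polytope of δ-BIC recommendation policies (`δ = 0` is `BIC[S]`). -/
def InBIC [Fintype Θ] [∀ i, Fintype (A i)] (ψ : Θ → ℝ) (q : Θ → X → ℝ)
    (u : (i : Fin n) → JA A → Θ → ℝ) (δ : ℝ) (x : JA A → X → ℝ) : Prop :=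
  IsRecPolicy x ∧ ∀ (i : Fin n) (ai ai' : A i),
    δ * (∑ θ, ψ θ * ∑' s : X, q θ s * ∑ a : JA A, (if a i = ai then x a s else 0)) ≤
      ∑ θ, ψ θ * ∑' s : X, q θ s *
        ∑ a : JA A,
          (if a i = ai then (u i a θ - u i (Function.update a i ai') θ) * x a s else 0)

/-- Expected reward of a recommendation policy `x`, with reward function `f`. -/
def recREW [Fintype Θ] [∀ i, Fintype (A i)] (ψ : Θ → ℝ) (q : Θ → X → ℝ)
    (f : JA A → Θ → ℝ) (x : JA A → X → ℝ) : ℝ :=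
  ∑ θ, ψ θ * ∑' s : X, q θ s * ∑ a : JA A, x a s * f a θ

/-- `REW*[S]`: the optimal expected reward over δ-BIC recommendation policies. -/
def REWstar [Fintype Θ] [∀ i, Fintype (A i)] (ψ : Θ → ℝ) (q : Θ → X → ℝ)
    (f : JA A → Θ → ℝ) (u : (i : Fin n) → JA A → Θ → ℝ) (δ : ℝ) : ℝ :=
  sSup {r : ℝ | ∃ x : JA A → X → ℝ, InBIC ψ q u δ x ∧ r = recREW ψ q f x}

/-- `EX_s[S]`: the signal-explorable joint actions at the feasible signal `s`. -/
def EXs [Fintype Θ] [∀ i, Fintype (A i)] (ψ : Θ → ℝ) (q : Θ → X → ℝ)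
    (u : (i : Fin n) → JA A → Θ → ℝ) (s : X) : Set (JA A) :=
  {a | ∃ x : JA A → X → ℝ, InBIC ψ q u 0 x ∧ 0 < x a s}

/-- Value type of the `AllInfo` signal. -/
abbrev AIVal (A : Fin n → Type) : Type := Finset (JA A) × (JA A → UVec n)

/-- The realization, at state `θ`, of the signal `AllInfo(B)`: the set `B θ` together
with the rewards/utilities of all joint actions in `B θ`. -/
def allInfoVal [∀ i, Fintype (A i)] (B : Θ → Finset (JA A)) (f : JA A → Θ → ℝ)
    (u : (i : Fin n) → JA A → Θ → ℝ) (θ : Θ) : AIVal A :=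
  (B θ, fun a => if a ∈ B θ then ((f a θ, fun i => u i a θ) : UVec n)
                 else (((0:ℝ), fun _ => (0:ℝ)) : UVec n))

/-- The signal kernel of `AllInfo(B)`. -/
def qAI [∀ i, Fintype (A i)] (B : Θ → Finset (JA A)) (f : JA A → Θ → ℝ)
    (u : (i : Fin n) → JA A → Θ → ℝ) : Θ → AIVal A → ℝ :=
  fun θ v => if v = allInfoVal B f u θ then (1:ℝ) else 0

/-- The set of δ-eventually-explorable joint actions given the state `θ`, for the
environment `D`: actions played with positive probability in some round by some
δ-BIC iterative recommendation policy. -/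
def explSet [Fintype Θ] [∀ i, Fintype (A i)] (ψ : Θ → ℝ)
    (D : JA A → Θ → UVec n → ℝ) (u : (i : Fin n) → JA A → Θ → ℝ) (δ : ℝ)
    (θ : Θ) : Finset (JA A) :=
  (Set.toFinite {a : JA A | ∃ P, IsBIC ψ P D u δ ∧ ∃ t, 0 < probAt P D θ t a}).toFinset

/-- The expected gain of agent `i` from following the recommendation `ai` rather than
deviating to `ai'`, as a linear functional of the recommendation policy. -/
def bicGain [Fintype Θ] [∀ i, Fintype (A i)] [Fintype X] (ψ : Θ → ℝ) (q : Θ → X → ℝ)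
    (u : (i : Fin n) → JA A → Θ → ℝ) (i : Fin n) (ai ai' : A i) :
    (JA A → X → ℝ) →ₗ[ℝ] ℝ where
  toFun x := ∑ θ, ψ θ * ∑ s : X, q θ s * ∑ a : JA A,
    (if a i = ai then (u i a θ - u i (Function.update a i ai') θ) * x a s else 0)
  map_add' x y := by
    simp only [← Finset.sum_add_distrib, ← mul_add]
    refine Finset.sum_congr rfl fun θ _ => ?_
    congr 1
    refine Finset.sum_congr rfl fun s _ => ?_
    congr 1
    refine Finset.sum_congr rfl fun a _ => ?_
    split_ifs
    · simp only [Pi.add_apply, mul_add]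
    · simp
  map_smul' c x := by
    simp only [RingHom.id_apply, smul_eq_mul, Finset.mul_sum]
    refine Finset.sum_congr rfl fun θ _ => ?_
    refine Finset.sum_congr rfl fun s _ => ?_
    refine Finset.sum_congr rfl fun a _ => ?_
    split_ifs
    · simp only [Pi.smul_apply, smul_eq_mul]
      ring
    · simp

theorem inBIC_zero_iff [Fintype Θ] [∀ i, Fintype (A i)] [Fintype X] {ψ : Θ → ℝ}
    {q : Θ → X → ℝ} {u : (i : Fin n) → JA A → Θ → ℝ} {x : JA A → X → ℝ} :
    InBIC ψ q u 0 x ↔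
      IsRecPolicy x ∧ ∀ (i : Fin n) (ai ai' : A i), 0 ≤ bicGain ψ q u i ai ai' x := by
  simp only [InBIC, zero_mul, tsum_fintype, bicGain, LinearMap.coe_mk, AddHom.coe_mk]

theorem IsRecPolicy.le_one [∀ i, Fintype (A i)] {x : JA A → X → ℝ} (hx : IsRecPolicy x)
    (a : JA A) (s : X) : x a s ≤ 1 :=
  (Finset.single_le_sum (f := fun a => x a s) (fun b _ => hx.1 b s)
    (Finset.mem_univ a)).trans_eq (hx.2 s)

theorem convex_setOf_inBIC [Fintype Θ] [∀ i, Fintype (A i)] [Fintype X] (ψ : Θ → ℝ)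
    (q : Θ → X → ℝ) (u : (i : Fin n) → JA A → Θ → ℝ) :
    Convex ℝ {x : JA A → X → ℝ | InBIC ψ q u 0 x} := by
  intro x hx y hy c d hc hd hcd
  rw [Set.mem_ofPred_eq, inBIC_zero_iff] at hx hy ⊢
  refine ⟨⟨fun a s => ?_, fun s => ?_⟩, fun i ai ai' => ?_⟩
  · exact add_nonneg (mul_nonneg hc (hx.1.1 a s)) (mul_nonneg hd (hy.1.1 a s))
  · simp only [Pi.add_apply, Pi.smul_apply, smul_eq_mul, Finset.sum_add_distrib,
      ← Finset.mul_sum, hx.1.2 s, hy.1.2 s, mul_one, hcd]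
  · rw [map_add, map_smul, map_smul]
    exact add_nonneg (mul_nonneg hc (hx.2 i ai ai')) (mul_nonneg hd (hy.2 i ai ai'))

theorem isCompact_setOf_inBIC [Fintype Θ] [∀ i, Fintype (A i)] [Fintype X] (ψ : Θ → ℝ)
    (q : Θ → X → ℝ) (u : (i : Fin n) → JA A → Θ → ℝ) :
    IsCompact {x : JA A → X → ℝ | InBIC ψ q u 0 x} := by
  refine (isCompact_Icc (a := (0 : JA A → X → ℝ)) (b := 1)).of_isClosed_subset ?_
    fun x hx => ⟨fun a s => hx.1.1 a s, fun a s => hx.1.le_one a s⟩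
  simp only [inBIC_zero_iff, IsRecPolicy, Set.ofPred_and, Set.ofPred_forall]
  refine ((isClosed_iInter fun a => isClosed_iInter fun s => ?_).inter
    (isClosed_iInter fun s => ?_)).inter
    (isClosed_iInter fun i => isClosed_iInter fun ai => isClosed_iInter fun ai' => ?_)
  · exact isClosed_le continuous_const (by fun_prop)
  · exact isClosed_eq (by fun_prop) continuous_const
  · exact isClosed_le continuous_const (LinearMap.continuous_of_finiteDimensional _)

/-- The largest probability with which a BIC policy plays `a` at signal `s` is attained. -/
theorem exists_inBIC_isGreatest [Fintype Θ] [∀ i, Fintype (A i)] [Fintype X]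
    {ψ : Θ → ℝ} {q : Θ → X → ℝ} {u : (i : Fin n) → JA A → Θ → ℝ}
    (hne : ∃ y : JA A → X → ℝ, InBIC ψ q u 0 y) (a : JA A) (s : X) :
    ∃ x, InBIC ψ q u 0 x ∧
      IsGreatest {p : ℝ | ∃ y : JA A → X → ℝ, InBIC ψ q u 0 y ∧ p = y a s} (x a s) := by
  obtain ⟨x, hx, hmax⟩ := (isCompact_setOf_inBIC ψ q u).exists_isMaxOn hne
    (f := fun y => y a s) (by fun_prop)
  exact ⟨x, hx, ⟨x, hx, rfl⟩, by rintro _ ⟨y, hy, rfl⟩; exact hmax hy⟩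

/-- existence of a max-support policy. In the recommendation game with
signal kernel `q` on finite support `X`, if some BIC recommendation policy exists,
then there is a BIC recommendation policy `x` whose support at every feasible signal
`s` is exactly the signal-explorable set `EX_s[S]`, and whose minimal support
probability is at least `p_min[S] / (|A|·|X|)`, where
`p_min[S] = min_{s, a ∈ EX_s[S]} max_{y ∈ BIC[S]} y a s`. -/
theorem max_support_policy
    {n : ℕ} {Θ : Type} {A : Fin n → Type} {X : Type}
    [Fintype Θ] [∀ i, Fintype (A i)] [Fintype X]
    (ψ : Θ → ℝ) (f : JA A → Θ → ℝ) (u : (i : Fin n) → JA A → Θ → ℝ)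
    (q : Θ → X → ℝ)
    (hψ : IsPrior ψ) (hu : IsUtil f u) (hq : IsSigKernel q)
    (hne : ∃ y : JA A → X → ℝ, InBIC ψ q u 0 y) :
    ∃ x : JA A → X → ℝ, InBIC ψ q u 0 x ∧
      (∀ (s : X) (a : JA A), 0 < x a s ↔ a ∈ EXs ψ q u s) ∧
      (∀ (s : X) (a : JA A), 0 < x a s →
        sInf {r : ℝ | ∃ (s' : X) (a' : JA A), a' ∈ EXs ψ q u s' ∧
              r = sSup {p : ℝ | ∃ y : JA A → X → ℝ, InBIC ψ q u 0 y ∧ p = y a' s'}}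
          / ((Fintype.card (JA A) : ℝ) * (Fintype.card X : ℝ)) ≤ x a s) := by
  rcases isEmpty_or_nonempty X with hX | ⟨⟨s₀⟩⟩
  · obtain ⟨y, hy⟩ := hne
    exact ⟨y, hy, fun s => isEmptyElim s, fun s => isEmptyElim s⟩
  have hJ : Nonempty (JA A) := by
    obtain ⟨y, hy⟩ := hne
    by_contra h
    rw [not_nonempty_iff] at h
    simpa using hy.1.2 s₀
  choose w hw hmax using fun p : JA A × X => exists_inBIC_isGreatest hne p.1 p.2
  set N : ℝ := (Fintype.card (JA A) : ℝ) * (Fintype.card X : ℝ)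
  have hNpos : 0 < N :=
    mul_pos (Nat.cast_pos.2 Fintype.card_pos)
      (Nat.cast_pos.2 (Fintype.card_pos_iff.2 ⟨s₀⟩))
  let x : JA A → X → ℝ := ∑ p : JA A × X, N⁻¹ • w p
  have hx : InBIC ψ q u 0 x := by
    refine (convex_setOf_inBIC ψ q u).sum_mem (fun _ _ => (inv_pos.2 hNpos).le) ?_
      fun p _ => hw p
    rw [Finset.sum_const, Finset.card_univ, Fintype.card_prod, nsmul_eq_mul, Nat.cast_mul]
    exact mul_inv_cancel₀ hNpos.ne'
  have hle (a : JA A) (s : X) : w (a, s) a s / N ≤ x a s := by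
    simp only [x, Finset.sum_apply, Pi.smul_apply, smul_eq_mul]
    rw [div_eq_inv_mul]
    exact Finset.single_le_sum (f := fun p => N⁻¹ * w p a s)
      (fun p _ => mul_nonneg (inv_pos.2 hNpos).le ((hw p).1.1 a s))
      (Finset.mem_univ (a, s))
  refine ⟨x, hx, fun s a => ⟨fun h => ⟨x, hx, h⟩, ?_⟩, fun s a h => ?_⟩
  · rintro ⟨y, hy, hpos⟩
    exact (div_pos (hpos.trans_le ((hmax (a, s)).2 ⟨y, hy, rfl⟩)) hNpos).trans_le (hle a s)
  · refine le_trans (div_le_div_of_nonneg_right (csInf_le ⟨0, ?_⟩ ?_) hNpos.le) (hle a s)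
    · rintro _ ⟨s', a', -, rfl⟩
      refine Real.sSup_nonneg ?_
      rintro _ ⟨y, hy, rfl⟩
      exact hy.1.1 a' s'
    · exact ⟨s, a, ⟨x, hx, h⟩, (hmax (a, s)).csSup_eq.symm⟩

end BE

end
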